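/- arXiv:2111.09885 — 3 statements merged into one kernel-verified Lean document; each statement's English description precedes it below -/
import Mathlib

section
/- Let Δ > 0 and let x be a real number with 0 < x, x + Δ < 1, and Δ/((x+Δ)(1−x)) ≤ 1/2. Then the derivative at x of the function t ↦ d(t, t+Δ) has absolute value at most Δ²/((x+Δ)(1−x)(1−x−Δ)) + (Δ/((x+Δ)(1−x)))². -/
/-- Bernoulli Kullback–Leibler divergence. -/
noncomputable def klBern (p q : ℝ) : ℝ :=
  p * Real.log (p / q) + (1 - p) * Real.log ((1 - p) / (1 - q))

theorem Real.abs_log_one_sub_add_le_sq {u : ℝ} (hu0 : 0 ≤ u) (hu : u ≤ 1 / 2) :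
    |Real.log (1 - u) + u| ≤ u ^ 2 := by
  rw [abs_le]
  constructor
  · have h := (abs_le.1 (Real.abs_log_sub_add_sum_range_le
      (show |u| < 1 by rw [abs_of_nonneg hu0]; linarith) 4)).1
    rw [abs_of_nonneg hu0] at h
    have h_rem : u ^ 5 / (1 - u) ≤ 2 * u ^ 5 := by
      rw [div_le_iff₀ (by linarith)]
      nlinarith [mul_nonneg (pow_nonneg hu0 5) (show 0 ≤ 1 - 2 * u by linarith)]
    have h_tail : u / 3 + u ^ 2 / 4 + 2 * u ^ 3 ≤ 1 / 2 := by
      have h2 : u ^ 2 ≤ (1 / 2) ^ 2 := by gcongr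
      have h3 : u ^ 3 ≤ (1 / 2) ^ 3 := by gcongr
      linarith
    have h_mul := mul_le_mul_of_nonneg_left h_tail (sq_nonneg u)
    norm_num [Finset.sum_range_succ] at h
    nlinarith
  · have := Real.log_le_sub_one_of_pos (show 0 < 1 - u by linarith)
    nlinarith [sq_nonneg u]

theorem hasDerivAt_klBern_shift {Δ x : ℝ} (hx : 0 < x) (hx1 : x < 1) (hxΔ0 : 0 < x + Δ)
    (hxΔ : x + Δ < 1) :
    HasDerivAt (fun t => klBern t (t + Δ))
      (Real.log (1 - Δ / ((x + Δ) * (1 - x))) + Δ / ((x + Δ) * (1 - (x + Δ)))) x := by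
  have h1 : 0 < 1 - x := by linarith
  have h2 : 0 < 1 - (x + Δ) := by linarith
  have hid := hasDerivAt_id' x
  have hsh := hid.add_const Δ
  have hsub := hid.const_sub 1
  have hkl := (hid.mul ((hid.div hsh hxΔ0.ne').log (div_pos hx hxΔ0).ne')).add
    (hsub.mul ((hsub.div (hsh.const_sub 1) h2.ne').log (div_pos h1 h2).ne'))
  have h_log : Real.log (1 - Δ / ((x + Δ) * (1 - x))) =
      Real.log (x / (x + Δ)) - Real.log ((1 - x) / (1 - (x + Δ))) := by
    rw [← Real.log_div (div_pos hx hxΔ0).ne' (div_pos h1 h2).ne']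
    congr 1
    field_simp
    ring
  refine hkl.congr_deriv ?_
  rw [h_log]
  simp only [Pi.div_apply]
  field_simp
  ring

/-- For `Δ > 0`, `0 < x`, `x + Δ < 1` and `Δ/((x+Δ)(1−x)) ≤ 1/2`, the derivative at `x` of
`t ↦ d(t, t+Δ)` has absolute value at most
`Δ²/((x+Δ)(1−x)(1−x−Δ)) + (Δ/((x+Δ)(1−x)))²`. -/
theorem abs_deriv_klBern_shift_le (Δ x : ℝ) (hΔ : 0 < Δ) (hx : 0 < x) (hxΔ : x + Δ < 1)
    (hhalf : Δ / ((x + Δ) * (1 - x)) ≤ 1 / 2) :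
    |deriv (fun t => klBern t (t + Δ)) x| ≤
      Δ ^ 2 / ((x + Δ) * (1 - x) * (1 - x - Δ)) + (Δ / ((x + Δ) * (1 - x))) ^ 2 := by
  have hx0 : 0 < x + Δ := by linarith
  have h1 : 0 < 1 - x := by linarith
  have h2 : 0 < 1 - x - Δ := by linarith
  rw [(hasDerivAt_klBern_shift hx (by linarith) hx0 hxΔ).deriv]
  have h_split : Δ / ((x + Δ) * (1 - (x + Δ))) = Δ / ((x + Δ) * (1 - x)) +
      Δ ^ 2 / ((x + Δ) * (1 - x) * (1 - x - Δ)) := by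
    rw [← sub_sub]
    field_simp
    ring
  rw [h_split, ← add_assoc, add_comm]
  refine (abs_add_le _ _).trans (add_le_add (abs_of_nonneg (by positivity)).le ?_)
  exact Real.abs_log_one_sub_add_le_sq (by positivity) hhalf
end

section
/- There exists a universal constant C > 0 such that for all real numbers l, u with 0 < l ≤ u < 1 and u − l ≤ (1/2)·min(l, 1−u), writing m = (l+u)/2, each of the four quantities d(m,u), d(u,m), d(m,l), d(l,m) differs from (u−l)²/(8m(1−m)) by at most C·(u−l)³/(l(1−l)·min(l, 1−u)). -/
theorem abs_log_one_add_sub_le {x : ℝ} (hx : |x| ≤ 1 / 4) :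
    |Real.log (1 + x) - (x - x ^ 2 / 2)| ≤ 2 * |x| ^ 3 := by
  have h := Real.abs_log_sub_add_sum_range_le (x := -x) (by rw [abs_neg]; linarith) 2
  rw [abs_neg, sub_neg_eq_add] at h
  have h_div : |x| ^ (2 + 1) / (1 - |x|) ≤ 2 * |x| ^ 3 := by
    rw [div_le_iff₀ (by linarith)]
    have h_cube := pow_nonneg (abs_nonneg x) 3
    norm_num only
    nlinarith [mul_nonneg h_cube (sub_nonneg.2 hx)]
  refine le_trans (le_of_eq ?_) (h.trans h_div)
  congr 1
  norm_num [Finset.sum_range_succ]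
  ring

theorem abs_one_add_mul_log_one_add_sub_le {x : ℝ} (hx : |x| ≤ 1 / 4) :
    |(1 + x) * Real.log (1 + x) - x - x ^ 2 / 2| ≤ 3 * |x| ^ 3 := by
  have h := abs_log_one_add_sub_le hx
  have h_one : |1 + x| ≤ 5 / 4 := by
    rw [abs_le] at hx ⊢
    constructor <;> linarith
  calc |(1 + x) * Real.log (1 + x) - x - x ^ 2 / 2|
      = |(1 + x) * (Real.log (1 + x) - (x - x ^ 2 / 2)) - x ^ 3 / 2| := by ring_nf
    _ ≤ |1 + x| * |Real.log (1 + x) - (x - x ^ 2 / 2)| + |x| ^ 3 / 2 := by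
      refine (abs_sub _ _).trans (le_of_eq ?_)
      rw [abs_mul, abs_div, abs_pow, abs_two]
    _ ≤ 5 / 4 * (2 * |x| ^ 3) + |x| ^ 3 / 2 := by gcongr
    _ = 3 * |x| ^ 3 := by ring

theorem abs_add_mul_log_div_sub_le {m d : ℝ} (hm : 0 < m) (hd : |d| ≤ m / 4) :
    |(m + d) * Real.log ((m + d) / m) - d - d ^ 2 / (2 * m)| ≤ 3 * |d| ^ 3 / m ^ 2 := by
  have hx : |d / m| ≤ 1 / 4 := by
    rw [abs_div, abs_of_pos hm, div_le_iff₀ hm]; linarith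
  have h := mul_le_mul_of_nonneg_left (abs_one_add_mul_log_one_add_sub_le hx) hm.le
  rw [← abs_of_pos hm, ← abs_mul, abs_of_pos hm, abs_div, abs_of_pos hm] at h
  rw [show (m + d) / m = 1 + d / m by rw [add_div, div_self hm.ne']]
  have h_rhs : m * (3 * (|d| / m) ^ 3) = 3 * |d| ^ 3 / m ^ 2 := by field_simp
  rw [h_rhs] at h
  refine le_trans (le_of_eq ?_) h
  congr 1
  field_simp

theorem abs_mul_log_div_add_sub_le {m d : ℝ} (hm : 0 < m) (hd : |d| ≤ m / 4) :
    |m * Real.log (m / (m + d)) + d - d ^ 2 / (2 * m)| ≤ 3 * |d| ^ 3 / m ^ 2 := by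
  have hx : |d / m| ≤ 1 / 4 := by
    rw [abs_div, abs_of_pos hm, div_le_iff₀ hm]; linarith
  have h_log : |Real.log (1 + d / m) - (d / m - (d / m) ^ 2 / 2)| ≤ 3 * |d / m| ^ 3 :=
    (abs_log_one_add_sub_le hx).trans (by gcongr; norm_num)
  have h := mul_le_mul_of_nonneg_left h_log hm.le
  rw [← abs_of_pos hm, ← abs_mul, abs_of_pos hm, abs_div, abs_of_pos hm, ← abs_neg] at h
  rw [← inv_div, Real.log_inv, show (m + d) / m = 1 + d / m by rw [add_div, div_self hm.ne']]
  have h_rhs : m * (3 * (|d| / m) ^ 3) = 3 * |d| ^ 3 / m ^ 2 := by field_simp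
  rw [h_rhs] at h
  refine le_trans (le_of_eq ?_) h
  congr 1
  field_simp
  ring

theorem abs_klBern_add_left_sub_le {m d : ℝ} (hm : 0 < m) (hm1 : m < 1) (hd : |d| ≤ m / 4)
    (hd1 : |d| ≤ (1 - m) / 4) :
    |klBern (m + d) m - d ^ 2 / (2 * m * (1 - m))| ≤
      3 * |d| ^ 3 / m ^ 2 + 3 * |d| ^ 3 / (1 - m) ^ 2 := by
  have hm1' : 0 < 1 - m := sub_pos.2 hm1
  have h := abs_add_mul_log_div_sub_le hm hd
  have h1 := abs_add_mul_log_div_sub_le (d := -d) hm1' (by rwa [abs_neg])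
  rw [abs_neg] at h1
  refine le_trans (le_of_eq ?_) ((abs_add_le _ _).trans (add_le_add h h1))
  congr 1
  rw [klBern, show 1 - (m + d) = 1 - m + -d by ring]
  field_simp
  ring

theorem abs_klBern_add_right_sub_le {m d : ℝ} (hm : 0 < m) (hm1 : m < 1) (hd : |d| ≤ m / 4)
    (hd1 : |d| ≤ (1 - m) / 4) :
    |klBern m (m + d) - d ^ 2 / (2 * m * (1 - m))| ≤
      3 * |d| ^ 3 / m ^ 2 + 3 * |d| ^ 3 / (1 - m) ^ 2 := by
  have hm1' : 0 < 1 - m := sub_pos.2 hm1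
  have h := abs_mul_log_div_add_sub_le hm hd
  have h1 := abs_mul_log_div_add_sub_le (d := -d) hm1' (by rwa [abs_neg])
  rw [abs_neg] at h1
  refine le_trans (le_of_eq ?_) ((abs_add_le _ _).trans (add_le_add h h1))
  congr 1
  rw [klBern, show 1 - (m + d) = 1 - m + -d by ring]
  field_simp
  ring

/-- There is a universal constant `C > 0` such that for `0 < l ≤ u < 1` with
`u − l ≤ (1/2)·min(l, 1−u)`, writing `m = (l+u)/2`, each of `d(m,u)`, `d(u,m)`, `d(m,l)`,
`d(l,m)` differs from `(u−l)²/(8m(1−m))` by at most `C·(u−l)³/(l(1−l)·min(l, 1−u))`. -/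
theorem klBern_midpoint_quarter_approx :
    ∃ C : ℝ, 0 < C ∧ ∀ l u : ℝ, 0 < l → l ≤ u → u < 1 →
      u - l ≤ (1 / 2) * min l (1 - u) →
      |klBern ((l + u) / 2) u - (u - l) ^ 2 / (8 * ((l + u) / 2) * (1 - (l + u) / 2))| ≤
        C * (u - l) ^ 3 / (l * (1 - l) * min l (1 - u)) ∧
      |klBern u ((l + u) / 2) - (u - l) ^ 2 / (8 * ((l + u) / 2) * (1 - (l + u) / 2))| ≤
        C * (u - l) ^ 3 / (l * (1 - l) * min l (1 - u)) ∧
      |klBern ((l + u) / 2) l - (u - l) ^ 2 / (8 * ((l + u) / 2) * (1 - (l + u) / 2))| ≤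
        C * (u - l) ^ 3 / (l * (1 - l) * min l (1 - u)) ∧
      |klBern l ((l + u) / 2) - (u - l) ^ 2 / (8 * ((l + u) / 2) * (1 - (l + u) / 2))| ≤
        C * (u - l) ^ 3 / (l * (1 - l) * min l (1 - u)) := by
  refine ⟨1, one_pos, fun l u hl hlu hu hmin => ?_⟩
  have h_left : u - l ≤ l / 2 := by linarith [min_le_left l (1 - u)]
  have h_right : u - l ≤ (1 - u) / 2 := by linarith [min_le_right l (1 - u)]
  have hu' : 0 < 1 - u := sub_pos.2 hu
  have h_min_pos : 0 < min l (1 - u) := lt_min hl hu'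
  obtain ⟨m, hm⟩ : ∃ m, m = (l + u) / 2 := ⟨_, rfl⟩
  obtain ⟨d, hd⟩ : ∃ d, d = (u - l) / 2 := ⟨_, rfl⟩
  have hd0 : 0 ≤ d := by linarith
  have hm0 : 0 < m := by linarith
  have hm1 : m < 1 := by linarith
  have hm1' : 0 < 1 - m := sub_pos.2 hm1
  have hdm : |d| ≤ m / 4 := by rw [abs_of_nonneg hd0]; linarith
  have hdm1 : |d| ≤ (1 - m) / 4 := by rw [abs_of_nonneg hd0]; linarith
  have h_den : 0 < l * (1 - l) * min l (1 - u) :=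
    mul_pos (mul_pos hl (by linarith)) h_min_pos
  have h_den_m : l * (1 - l) * min l (1 - u) ≤ m ^ 2 := by
    calc l * (1 - l) * min l (1 - u) ≤ l * 1 * l := by
          gcongr
          · linarith
          · exact min_le_left _ _
      _ ≤ m ^ 2 := by nlinarith
  have h_den_m1 : l * (1 - l) * min l (1 - u) ≤ 3 / 2 * (1 - m) ^ 2 := by
    calc l * (1 - l) * min l (1 - u) ≤ 1 * (3 / 2 * (1 - m)) * (1 - m) := by
          gcongr
          · linarith
          · linarith
          · linarith
          · exact (min_le_right _ _).trans (by linarith)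
      _ = 3 / 2 * (1 - m) ^ 2 := by ring
  have h_bound : 3 * |d| ^ 3 / m ^ 2 + 3 * |d| ^ 3 / (1 - m) ^ 2 ≤
      1 * (u - l) ^ 3 / (l * (1 - l) * min l (1 - u)) := by
    rw [abs_of_nonneg hd0, show u - l = 2 * d by linarith]
    have h1 : 3 * d ^ 3 / m ^ 2 ≤ 3 * d ^ 3 / (l * (1 - l) * min l (1 - u)) := by gcongr
    have h2 : 3 * d ^ 3 / (1 - m) ^ 2 ≤ 9 / 2 * d ^ 3 / (l * (1 - l) * min l (1 - u)) := by
      rw [div_le_div_iff₀ (by positivity) h_den]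
      nlinarith [pow_nonneg hd0 3]
    calc _ ≤ _ := add_le_add h1 h2
      _ ≤ _ := by
        rw [← add_div]
        gcongr
        nlinarith [pow_nonneg hd0 3]
  have h_eq : (u - l) ^ 2 / (8 * m * (1 - m)) = d ^ 2 / (2 * m * (1 - m)) := by
    rw [show u - l = 2 * d by linarith]
    field_simp
    ring
  have h_eq_neg : d ^ 2 = (-d) ^ 2 := by ring
  rw [← hm, h_eq]
  obtain rfl : u = m + d := by linarith
  obtain rfl : l = m + -d := by linarith
  refine ⟨(abs_klBern_add_right_sub_le hm0 hm1 hdm hdm1).trans h_bound,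
    (abs_klBern_add_left_sub_le hm0 hm1 hdm hdm1).trans h_bound, ?_, ?_⟩
  all_goals
    rw [← abs_neg d] at hdm hdm1 h_bound
    rw [h_eq_neg]
  · exact (abs_klBern_add_right_sub_le hm0 hm1 hdm hdm1).trans h_bound
  · exact (abs_klBern_add_left_sub_le hm0 hm1 hdm hdm1).trans h_bound
end

section
/- Fix μ* ∈ (0,1), η > 0 and c > 0, and for real T > 1 set B(T) = √(c·log T / T). Then lim_{T→∞} T · ∫_{μ*}^{μ* + 2B(T)} (x − μ*) · exp(−(1+η)·T·d(μ*, x)) dx = μ*(1−μ*)/(1+η), where the limit is taken as the real parameter T tends to infinity. -/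
open scoped Real

open Filter Topology Set

lemma klBern_self {p : ℝ} (hp0 : 0 < p) (hp1 : p < 1) : klBern p p = 0 := by
  simp [klBern, div_self hp0.ne', div_self (sub_pos.2 hp1).ne']

lemma hasDerivAt_klBern {p x : ℝ} (hp0 : 0 < p) (hp1 : p < 1) (hx0 : 0 < x) (hx1 : x < 1) :
    HasDerivAt (klBern p) ((x - p) / (x * (1 - x))) x := by
  have hx1' : 0 < 1 - x := sub_pos.2 hx1
  have hp1' : 0 < 1 - p := sub_pos.2 hp1
  have h1 := (((hasDerivAt_const x p).div (hasDerivAt_id x) hx0.ne').log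
    (div_pos hp0 hx0).ne').const_mul p
  have h2 := (((hasDerivAt_const x (1 - p)).div ((hasDerivAt_id x).const_sub 1) hx1'.ne').log
    (div_pos hp1' hx1').ne').const_mul (1 - p)
  refine (h1.add h2).congr_deriv ?_
  simp only [id, Pi.div_apply]
  field_simp
  ring

/-- Pinsker's inequality for Bernoulli distributions, for `p ≤ x`. -/
lemma two_mul_sq_sub_le_klBern {p x : ℝ} (hp0 : 0 < p) (hpx : p ≤ x) (hx1 : x < 1) :
    2 * (x - p) ^ 2 ≤ klBern p x := by
  have hp1 : p < 1 := hpx.trans_lt hx1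
  have hd : ∀ y ∈ Icc p x, HasDerivAt (fun y => klBern p y - 2 * (y - p) ^ 2)
      ((y - p) / (y * (1 - y)) - 4 * (y - p)) y := by
    intro y hy
    have h := (hasDerivAt_klBern hp0 hp1 (hp0.trans_le hy.1) (hy.2.trans_lt hx1)).sub
      ((((hasDerivAt_id y).sub_const p).pow 2).const_mul 2)
    refine h.congr_deriv ?_
    simp only [id]
    push_cast
    ring
  have hmono : MonotoneOn (fun y => klBern p y - 2 * (y - p) ^ 2) (Icc p x) := by
    refine monotoneOn_of_hasDerivWithinAt_nonneg (convex_Icc p x)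
      (fun y hy => (hd y hy).continuousAt.continuousWithinAt)
      (fun y hy => (hd y (interior_subset hy)).hasDerivWithinAt) ?_
    intro y hy
    have hy' := interior_subset hy
    have h0 : 0 < y := hp0.trans_le hy'.1
    have h1 : 0 < 1 - y := sub_pos.2 (hy'.2.trans_lt hx1)
    rw [sub_nonneg, le_div_iff₀ (mul_pos h0 h1)]
    nlinarith [mul_nonneg (sub_nonneg.2 hy'.1) (sq_nonneg (2 * y - 1))]
  have h := hmono (left_mem_Icc.2 hpx) (right_mem_Icc.2 hpx) hpx
  simp only [klBern_self hp0 hp1] at h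
  linarith

lemma continuousOn_klBern_deriv {p b : ℝ} (hp0 : 0 < p) (hpb : p + b < 1) :
    ContinuousOn (fun x => (x - p) / (x * (1 - x))) (Icc p (p + b)) := by
  refine ContinuousOn.div (by fun_prop) (by fun_prop) fun x hx => ?_
  exact (mul_pos (hp0.trans_le hx.1) (by linarith [hx.2])).ne'

lemma continuousOn_klBern {p b : ℝ} (hp0 : 0 < p) (hp1 : p < 1) (hpb : p + b < 1) :
    ContinuousOn (klBern p) (Icc p (p + b)) := fun _ hx =>
  (hasDerivAt_klBern hp0 hp1 (hp0.trans_le hx.1)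
    (hx.2.trans_lt hpb)).continuousAt.continuousWithinAt

lemma integral_klBern_deriv_mul_exp {p b s : ℝ} (hp0 : 0 < p) (hp1 : p < 1) (hb : 0 ≤ b)
    (hpb : p + b < 1) (hs : s ≠ 0) :
    ∫ x in p..(p + b), (x - p) / (x * (1 - x)) * Real.exp (-s * klBern p x) =
      (1 - Real.exp (-s * klBern p (p + b))) / s := by
  have hle : p ≤ p + b := by linarith
  rw [intervalIntegral.integral_eq_sub_of_hasDerivAt
    (f := fun x => -(Real.exp (-s * klBern p x)) / s)]
  · simp only [klBern_self hp0 hp1, mul_zero, Real.exp_zero]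
    ring
  · intro x hx
    rw [uIcc_of_le hle] at hx
    have h := ((((hasDerivAt_klBern hp0 hp1 (hp0.trans_le hx.1)
      (hx.2.trans_lt hpb)).const_mul (-s)).exp).neg).div_const s
    refine h.congr_deriv ?_
    field_simp
  · refine ContinuousOn.intervalIntegrable ?_
    rw [uIcc_of_le hle]
    exact (continuousOn_klBern_deriv hp0 hpb).mul
      (Real.continuous_exp.comp_continuousOn
        (continuousOn_const.mul (continuousOn_klBern hp0 hp1 hpb)))

/-- Replacing the variance `x * (1 - x)` by `p * (1 - p)` on `[p, p + b]` costs at most `b`. -/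
lemma integral_sub_mul_exp_klBern_bounds {p b s : ℝ} (hp0 : 0 < p) (hp1 : p < 1) (hb : 0 ≤ b)
    (hpb : p + b < 1) (hs : s ≠ 0) :
    (p * (1 - p) - b) * ((1 - Real.exp (-s * klBern p (p + b))) / s) ≤
        ∫ x in p..(p + b), (x - p) * Real.exp (-s * klBern p x) ∧
      ∫ x in p..(p + b), (x - p) * Real.exp (-s * klBern p x) ≤
        (p * (1 - p) + b) * ((1 - Real.exp (-s * klBern p (p + b))) / s) := by
  have hle : p ≤ p + b := by linarith
  have hexp : ContinuousOn (fun x => Real.exp (-s * klBern p x)) (Icc p (p + b)) :=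
    Real.continuous_exp.comp_continuousOn
      (continuousOn_const.mul (continuousOn_klBern hp0 hp1 hpb))
  have hintg : IntervalIntegrable (fun x => (x - p) * Real.exp (-s * klBern p x))
      MeasureTheory.volume p (p + b) := by
    refine ContinuousOn.intervalIntegrable ?_
    rw [uIcc_of_le hle]
    exact ContinuousOn.mul (by fun_prop) hexp
  have hintg' : ∀ v : ℝ, IntervalIntegrable
      (fun x => v * ((x - p) / (x * (1 - x)) * Real.exp (-s * klBern p x)))
      MeasureTheory.volume p (p + b) := by
    intro v
    refine ContinuousOn.intervalIntegrable ?_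
    rw [uIcc_of_le hle]
    exact continuousOn_const.mul ((continuousOn_klBern_deriv hp0 hpb).mul hexp)
  have hfac : ∀ x ∈ Icc p (p + b), (x - p) * Real.exp (-s * klBern p x) =
      (x * (1 - x)) * ((x - p) / (x * (1 - x)) * Real.exp (-s * klBern p x)) := by
    intro x hx
    have h0 : 0 < x := hp0.trans_le hx.1
    have h1 : 0 < 1 - x := by linarith [hx.2]
    field_simp
  have hnn : ∀ x ∈ Icc p (p + b),
      0 ≤ (x - p) / (x * (1 - x)) * Real.exp (-s * klBern p x) := by
    intro x hx
    have h0 : 0 < x := hp0.trans_le hx.1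
    have h1 : 0 < 1 - x := by linarith [hx.2]
    have h2 : 0 ≤ x - p := sub_nonneg.2 hx.1
    positivity
  rw [← integral_klBern_deriv_mul_exp hp0 hp1 hb hpb hs,
    ← intervalIntegral.integral_const_mul, ← intervalIntegral.integral_const_mul]
  constructor
  · refine intervalIntegral.integral_mono_on hle (hintg' _) hintg fun x hx => ?_
    rw [hfac x hx]
    refine mul_le_mul_of_nonneg_right ?_ (hnn x hx)
    nlinarith [hx.1, hx.2, mul_nonneg (sub_nonneg.2 hx.1) (by linarith [hx.2] : 0 ≤ 2 - x - p)]
  · refine intervalIntegral.integral_mono_on hle hintg (hintg' _) fun x hx => ?_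
    rw [hfac x hx]
    refine mul_le_mul_of_nonneg_right ?_ (hnn x hx)
    nlinarith [hx.1, hx.2, mul_nonneg (sub_nonneg.2 hx.1) (by linarith [hx.1] : 0 ≤ x + p)]

lemma tendsto_sqrt_mul_log_div (c : ℝ) :
    Tendsto (fun T : ℝ => Real.sqrt (c * Real.log T / T)) atTop (𝓝 0) := by
  have h : Tendsto (fun T : ℝ => c * (Real.log T / T)) atTop (𝓝 (c * 0)) :=
    Real.isLittleO_log_id_atTop.tendsto_div_nhds_zero.const_mul c
  simpa [mul_div_assoc] using h.sqrt

/-- With `B(T) = √(c·log T / T)`, the scaled integral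
`T · ∫_{μ*}^{μ*+2B(T)} (x − μ*)·exp(−(1+η)·T·d(μ*, x)) dx` tends to
`μ*(1−μ*)/(1+η)` as the real parameter `T → ∞`. -/
theorem tendsto_integral_lower_bound (μs η c : ℝ) (hμ0 : 0 < μs) (hμ1 : μs < 1)
    (hη : 0 < η) (hc : 0 < c) :
    Filter.Tendsto
      (fun T : ℝ => T * ∫ x in μs..(μs + 2 * Real.sqrt (c * Real.log T / T)),
        (x - μs) * Real.exp (-(1 + η) * T * klBern μs x))
      Filter.atTop (nhds (μs * (1 - μs) / (1 + η))) := by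
  set b : ℝ → ℝ := fun T => 2 * Real.sqrt (c * Real.log T / T) with hb
  have hb0 : Tendsto b atTop (𝓝 0) := by
    simpa [hb] using (tendsto_sqrt_mul_log_div c).const_mul 2
  have hbnn : ∀ T, 0 ≤ b T := fun T => by positivity
  have hk : 0 < 1 + η := by linarith
  have hev : ∀ᶠ T : ℝ in atTop, 1 < T ∧ μs + b T < 1 := by
    refine (eventually_gt_atTop 1).and ?_
    filter_upwards [hb0.eventually_lt_const (sub_pos.2 hμ1)] with T hT
    linarith
  have hexponent : Tendsto (fun T => (1 + η) * T * klBern μs (μs + b T)) atTop atTop := by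
    refine tendsto_atTop_mono' atTop ?_
      (Real.tendsto_log_atTop.const_mul_atTop (by positivity : 0 < (1 + η) * (8 * c)))
    filter_upwards [hev] with T hT
    have hT0 : 0 < T := by linarith [hT.1]
    have hlog : 0 ≤ Real.log T := Real.log_nonneg hT.1.le
    have hpinsker := two_mul_sq_sub_le_klBern hμ0 (by linarith [hbnn T]) hT.2
    have hsq : b T ^ 2 = 4 * (c * Real.log T / T) := by
      simp only [hb, mul_pow, Real.sq_sqrt (by positivity : 0 ≤ c * Real.log T / T)]
      norm_num
    rw [add_sub_cancel_left, hsq] at hpinsker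
    calc (1 + η) * (8 * c) * Real.log T
        = (1 + η) * T * (2 * (4 * (c * Real.log T / T))) := by field_simp; ring
      _ ≤ _ := mul_le_mul_of_nonneg_left hpinsker (by positivity)
  have hmass : Tendsto
      (fun T => (1 - Real.exp (-((1 + η) * T * klBern μs (μs + b T)))) / (1 + η))
      atTop (𝓝 (1 / (1 + η))) := by
    simpa using ((Real.tendsto_exp_neg_atTop_nhds_zero.comp hexponent).const_sub 1).div_const
      (1 + η)
  have hlower := (hb0.const_sub (μs * (1 - μs))).mul hmass
  have hupper := (hb0.const_add (μs * (1 - μs))).mul hmass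
  rw [sub_zero, mul_one_div] at hlower
  rw [add_zero, mul_one_div] at hupper
  have hbounds : ∀ T : ℝ, 1 < T ∧ μs + b T < 1 → _ := fun T hT =>
    integral_sub_mul_exp_klBern_bounds (s := (1 + η) * T) hμ0 hμ1 (hbnn T) hT.2
      (mul_pos hk (by linarith [hT.1])).ne'
  refine tendsto_of_tendsto_of_tendsto_of_le_of_le' hlower hupper ?_ ?_
  · filter_upwards [hev] with T hT
    have hT0 : 0 < T := by linarith [hT.1]
    have h := mul_le_mul_of_nonneg_left (hbounds T hT).1 hT0.le
    simp only [neg_mul] at h ⊢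
    refine le_trans (le_of_eq ?_) h
    field_simp
  · filter_upwards [hev] with T hT
    have hT0 : 0 < T := by linarith [hT.1]
    have h := mul_le_mul_of_nonneg_left (hbounds T hT).2 hT0.le
    simp only [neg_mul] at h ⊢
    refine le_trans h (le_of_eq ?_)
    field_simp
end
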